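/- Suppose 0 < k ≤ q and 0 ≤ β < kn/q. Then S_Ω(β,k) > S, i.e. the weighted infimum is strictly larger than the best Sobolev constant. -/

import Mathlib

open MeasureTheory Filter Topology Set

noncomputable section

def smoothCpt (n : ℕ) (Ω : Set (EuclideanSpace ℝ (Fin n)))
    (u : EuclideanSpace ℝ (Fin n) → ℝ) : Prop :=
  ContDiff ℝ (⊤ : ℕ∞) u ∧ HasCompactSupport u ∧ tsupport u ⊆ Ω

/-- The weighted energy `I_{Ω;β,k}(u) = ∫_Ω (1+|x|^β |u|^k) |∇u|²`. -/
def energy (n : ℕ) (Ω : Set (EuclideanSpace ℝ (Fin n))) (β k : ℝ)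
    (u : EuclideanSpace ℝ (Fin n) → ℝ) : ℝ :=
  ∫ x in Ω, (1 + ‖x‖ ^ β * |u x| ^ k) * ‖gradient u x‖ ^ 2

/-- `S_Ω(β,k)`: infimum of the weighted energy over `C_c^∞(Ω)` functions normalized in `L^q`. -/
def Sw (n : ℕ) (Ω : Set (EuclideanSpace ℝ (Fin n))) (β k q : ℝ) : ℝ :=
  sInf {c | ∃ u, smoothCpt n Ω u ∧ (∫ x in Ω, |u x| ^ q) = 1 ∧ c = energy n Ω β k u}

/-- The best Sobolev constant `S`. -/
def Sbest (n : ℕ) (Ω : Set (EuclideanSpace ℝ (Fin n))) (q : ℝ) : ℝ :=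
  sInf {c | ∃ u, smoothCpt n Ω u ∧ (∫ x in Ω, |u x| ^ q) = 1 ∧
    c = ∫ x in Ω, ‖gradient u x‖ ^ 2}

lemma norm_gradient_eq_norm_fderiv {n : ℕ} (u : EuclideanSpace ℝ (Fin n) → ℝ)
    (x : EuclideanSpace ℝ (Fin n)) : ‖gradient u x‖ = ‖fderiv ℝ u x‖ := by
  simp [gradient]

/-- Negative powers of the norm are in `L^p` on bounded sets when `a * p < n`. -/
lemma memLp_norm_rpow_neg {n : ℕ} (hn : 1 ≤ n) {Ω : Set (EuclideanSpace ℝ (Fin n))}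
    (hΩ : Bornology.IsBounded Ω) {a p : ℝ} (hp : 0 < p) (hap : a * p < n) :
    MemLp (fun x : EuclideanSpace ℝ (Fin n) => ‖x‖ ^ (-a)) (ENNReal.ofReal p)
      (volume.restrict Ω) := by
  have hmeas : Measurable (fun x : EuclideanSpace ℝ (Fin n) => ‖x‖ ^ (-a)) := by fun_prop
  have hmeas' : Measurable (fun x : EuclideanSpace ℝ (Fin n) => ‖x‖ ^ (-(a * p))) := by fun_prop
  obtain ⟨R, hR⟩ := hΩ.subset_ball (0 : EuclideanSpace ℝ (Fin n))
  have hint : IntegrableOn (fun x : EuclideanSpace ℝ (Fin n) => ‖x‖ ^ (-(a * p)))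
      (Metric.ball 0 R) := by
    refine integrableOn_ball_of_norm_le_rpow (α := a * p) (C := 1) (by simpa using hn)
      (by simpa using hap) (Eventually.of_forall fun x => ?_) hmeas'.aestronglyMeasurable
    rw [one_mul, Real.norm_of_nonneg (by positivity)]
  have hint' := hint.mono_set hR
  rw [← integrable_norm_rpow_iff hmeas.aestronglyMeasurable (by simpa using hp)
    ENNReal.ofReal_ne_top, ENNReal.toReal_ofReal hp.le]
  refine hint'.congr (Eventually.of_forall fun x => ?_)
  simp only
  rw [Real.norm_of_nonneg (by positivity), ← Real.rpow_mul (norm_nonneg _), neg_mul]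

/-- The density of the weighted part of the energy is continuous. -/
lemma continuous_weighted_density {n : ℕ} {β k : ℝ} (hk : 0 ≤ k) (hβ : 0 ≤ β)
    {u : EuclideanSpace ℝ (Fin n) → ℝ} (hu : ContDiff ℝ (⊤ : ℕ∞) u) :
    Continuous fun x => ‖x‖ ^ β * |u x| ^ k * ‖gradient u x‖ ^ 2 := by
  simp only [norm_gradient_eq_norm_fderiv]
  have h1 : Continuous u := hu.continuous
  have h2 : Continuous (fderiv ℝ u) := hu.continuous_fderiv (by simp)
  exact ((continuous_norm.rpow_const fun _ => Or.inr hβ).mul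
    (h1.abs.rpow_const fun _ => Or.inr hk)).mul (h2.norm.pow 2)

lemma hasCompactSupport_gradient {n : ℕ} {u : EuclideanSpace ℝ (Fin n) → ℝ}
    (hu : HasCompactSupport u) : HasCompactSupport (gradient u) := by
  refine (hu.fderiv (𝕜 := ℝ)).mono fun x hx => ?_
  rwa [Function.mem_support, ← norm_ne_zero_iff, ← norm_gradient_eq_norm_fderiv,
    norm_ne_zero_iff]

lemma eLpNorm_restrict_eq_of_support_subset_of_normed {α F : Type*} [MeasurableSpace α]
    [NormedAddCommGroup F] {μ : Measure α} {p : ENNReal} {f : α → F} {s : Set α}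
    (hf : Function.support f ⊆ s) : eLpNorm f p (μ.restrict s) = eLpNorm f p μ :=
  eLpNorm_restrict_eq_of_support_subset hf

/-- The Gagliardo–Nirenberg–Sobolev inequality on a set containing the support. -/
lemma eLpNorm_restrict_le_eLpNorm_fderiv {n : ℕ} (hn : 0 < n)
    {Ω : Set (EuclideanSpace ℝ (Fin n))} {w : EuclideanSpace ℝ (Fin n) → ℝ}
    (hw : ContDiff ℝ 1 w) (hcpt : HasCompactSupport w) (hsupp : tsupport w ⊆ Ω)
    {r s : NNReal} (hr : 1 ≤ r) (hsr : (s : ℝ)⁻¹ = (r : ℝ)⁻¹ - (n : ℝ)⁻¹) :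
    eLpNorm w s (volume.restrict Ω) ≤
      SNormLESNormFDerivOfEqConst ℝ (volume : Measure (EuclideanSpace ℝ (Fin n))) r *
        eLpNorm (fderiv ℝ w) r (volume.restrict Ω) := by
  have hfsupp : Function.support (fderiv ℝ w) ⊆ Ω := (support_fderiv_subset ℝ).trans hsupp
  have hres : eLpNorm (fderiv ℝ w) r (volume.restrict Ω) = eLpNorm (fderiv ℝ w) r volume :=
    eLpNorm_restrict_eq_of_support_subset_of_normed hfsupp
  rw [hres]
  exact (eLpNorm_restrict_le ..).trans
    (eLpNorm_le_eLpNorm_fderiv_of_eq volume hw hcpt hr (by simpa using hn) (by simpa using hsr))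

/-- Chain rule, Hölder and Gagliardo–Nirenberg–Sobolev: the weighted energy controls the
`L^q` norm. -/
lemma exists_weighted_bound {n : ℕ} (hn : 3 ≤ n) {q : ℝ} (hq : q = 2 * n / (n - 2))
    {Ω : Set (EuclideanSpace ℝ (Fin n))} (hΩb : Bornology.IsBounded Ω)
    {β k : ℝ} (hk0 : 0 < k) (hkq : k ≤ q) (hβ0 : 0 ≤ β) (hβ : β < k * n / q) :
    ∃ K : ℝ, 0 < K ∧ ∀ u, smoothCpt n Ω u → (∫ x in Ω, |u x| ^ q) = 1 →
      1 ≤ K * √(∫ x in Ω, ‖x‖ ^ β * |u x| ^ k * ‖gradient u x‖ ^ 2) := by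
  have hn3 : (3 : ℝ) ≤ n := by exact_mod_cast hn
  have hn0 : (0 : ℝ) < n := by linarith
  have hq0 : 0 < q := by rw [hq]; apply div_pos <;> linarith
  have hqinv : q⁻¹ = 2⁻¹ - (n : ℝ)⁻¹ := by
    rw [hq]; have : (n : ℝ) - 2 ≠ 0 := by linarith
    field_simp
  set m : ℝ := 1 + k / 2 with hm
  have hm1 : 1 < m := by linarith
  set s : ℝ := q / m with hs
  have hs0 : 0 < s := by positivity
  set p : ℝ := 2 * q / k with hp
  have hp0 : 0 < p := by positivity
  have hsinv : s⁻¹ = q⁻¹ + k / (2 * q) := by rw [hs, hm]; field_simp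
  set r : ℝ := (p⁻¹ + 2⁻¹)⁻¹ with hr
  have hr0 : 0 < r := by positivity
  have hpinv : p⁻¹ = k / (2 * q) := by rw [hp, inv_div]
  have hr1 : 1 ≤ r := by
    rw [hr, one_le_inv₀ (by positivity), hpinv]
    have : k / (2 * q) ≤ 2⁻¹ := by
      rw [div_le_iff₀ (by positivity)]; linarith
    linarith
  have hsr : s⁻¹ = r⁻¹ - (n : ℝ)⁻¹ := by
    rw [hsinv, hr, inv_inv, hpinv, hqinv]; ring
  have htriple : ENNReal.HolderTriple (ENNReal.ofReal p) 2 (ENNReal.ofReal r) := by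
    simpa using (Real.HolderTriple.of_pos hp0 two_pos).ennrealOfReal
  have hweight := memLp_norm_rpow_neg (by omega) hΩb (a := β / 2) hp0 (by
    rw [lt_div_iff₀ hq0] at hβ
    rw [hp]
    rw [show β / 2 * (2 * q / k) = β * q / k by ring, div_lt_iff₀ hk0]
    linarith)
  set B := eLpNorm (fun x : EuclideanSpace ℝ (Fin n) => ‖x‖ ^ (-(β / 2))) (ENNReal.ofReal p)
    (volume.restrict Ω) with hB
  have hBtop : B ≠ ⊤ := hweight.2.ne
  set C : NNReal := SNormLESNormFDerivOfEqConst ℝ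
    (volume : Measure (EuclideanSpace ℝ (Fin n))) r.toNNReal with hC
  refine ⟨C * (m.toNNReal * B.toReal) + 1, by positivity, ?_⟩
  rintro u ⟨hu, hucpt, husupp⟩ hnorm
  have hu1 : ContDiff ℝ 1 u := hu.of_le (by exact_mod_cast le_top)
  set w : EuclideanSpace ℝ (Fin n) → ℝ := fun x => ‖u x‖ ^ m with hw
  have hwC : ContDiff ℝ 1 w := hu1.norm_rpow hm1
  have hwsupp : Function.support w ⊆ Function.support u := by
    intro x hx
    contrapose! hx
    simp only [Function.mem_support, not_not] at hx ⊢
    simp [hw, hx, (by linarith : m ≠ 0)]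
  have hwcpt : HasCompactSupport w := hucpt.mono hwsupp
  have hGNS := eLpNorm_restrict_le_eLpNorm_fderiv (by omega) hwC hwcpt
    ((closure_mono hwsupp).trans husupp) (r := r.toNNReal) (s := s.toNNReal)
    (by simpa using hr1) (by simpa only [Real.coe_toNNReal _ hr0.le, Real.coe_toNNReal _ hs0.le])
  have hLHS : eLpNorm w s.toNNReal (volume.restrict Ω) = 1 := by
    have hmem : MemLp w s.toNNReal (volume.restrict Ω) :=
      (hwC.continuous.memLp_of_hasCompactSupport hwcpt)
    rw [hmem.eLpNorm_eq_integral_rpow_norm (by simpa using hs0) (by simp)]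
    have : ∀ x, ‖w x‖ ^ s = |u x| ^ q := fun x => by
      rw [hw, Real.norm_of_nonneg (by positivity), ← Real.rpow_mul (norm_nonneg _),
        Real.norm_eq_abs, hs, mul_div_cancel₀ _ (by linarith : m ≠ 0)]
    simp only [ENNReal.coe_toReal, Real.coe_toNNReal _ hs0.le, this, hnorm, Real.one_rpow,
      ENNReal.ofReal_one]
  set g : EuclideanSpace ℝ (Fin n) → ℝ :=
    fun x => √(‖x‖ ^ β * |u x| ^ k * ‖gradient u x‖ ^ 2) with hg
  have hgC : Continuous g := (continuous_weighted_density hk0.le hβ0 hu).sqrt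
  have hgcpt : HasCompactSupport g := by
    refine (hasCompactSupport_gradient hucpt).mono fun x hx => ?_
    contrapose! hx
    simp only [Function.mem_support, not_not] at hx ⊢
    simp [hg, hx]
  have hg2 : eLpNorm g 2 (volume.restrict Ω) =
      ENNReal.ofReal √(∫ x in Ω, ‖x‖ ^ β * |u x| ^ k * ‖gradient u x‖ ^ 2) := by
    have hmem : MemLp g 2 (volume.restrict Ω) := hgC.memLp_of_hasCompactSupport hgcpt
    rw [hmem.eLpNorm_eq_integral_rpow_norm two_ne_zero (by simp), Real.sqrt_eq_rpow]
    have : ∀ x, ‖g x‖ ^ (2 : ℝ) = ‖x‖ ^ β * |u x| ^ k * ‖gradient u x‖ ^ 2 := fun x => by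
      rw [Real.rpow_two, Real.norm_eq_abs, sq_abs, Real.sq_sqrt (by positivity)]
    simp only [ENNReal.toReal_ofNat, this, one_div]
  have hpt : ∀ x, x ≠ 0 → ‖fderiv ℝ w x‖ ≤ m * (‖x‖ ^ (-(β / 2)) * g x) := fun x hx => by
    refine (norm_fderiv_norm_rpow_le (hu1.differentiable one_ne_zero) hm1).trans_eq ?_
    have hx' : 0 < ‖x‖ := norm_pos_iff.mpr hx
    rw [hg]
    simp only
    rw [Real.sqrt_mul (by positivity), Real.sqrt_mul (by positivity),
      Real.sqrt_sq (norm_nonneg _), norm_gradient_eq_norm_fderiv, Real.sqrt_eq_rpow,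
      Real.sqrt_eq_rpow, ← Real.rpow_mul hx'.le, ← Real.rpow_mul (abs_nonneg _),
      Real.norm_eq_abs, show m - 1 = k * (1 / 2) by rw [hm]; ring, ← mul_assoc, ← mul_assoc,
      ← mul_assoc, mul_assoc m (‖x‖ ^ (-(β / 2))), ← Real.rpow_add hx',
      show -(β / 2) + β * (1 / 2) = 0 by ring, Real.rpow_zero, mul_one]
  have hne : ∀ᵐ x : EuclideanSpace ℝ (Fin n) ∂(volume.restrict Ω), x ≠ 0 := by
    have : Nontrivial (EuclideanSpace ℝ (Fin n)) :=
      Module.nontrivial_of_finrank_pos (R := ℝ) (by simp; omega)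
    exact ae_restrict_of_ae (Measure.ae_ne volume 0)
  have hHolder : eLpNorm (fderiv ℝ w) (ENNReal.ofReal r) (volume.restrict Ω) ≤
      m.toNNReal * (B * eLpNorm g 2 (volume.restrict Ω)) := by
    refine (eLpNorm_le_nnreal_smul_eLpNorm_of_ae_le_mul (c := m.toNNReal)
      (g := (fun x : EuclideanSpace ℝ (Fin n) => ‖x‖ ^ (-(β / 2))) • g) ?_ _).trans ?_
    · filter_upwards [hne] with x hx
      rw [← NNReal.coe_le_coe]
      have := hpt x hx
      have hg0 : 0 ≤ g x := Real.sqrt_nonneg _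
      simpa [abs_of_nonneg, hg0, (by linarith : 0 ≤ m), Real.rpow_nonneg] using this
    · rw [ENNReal.smul_def, smul_eq_mul]
      gcongr
      exact eLpNorm_smul_le_mul_eLpNorm hgC.aestronglyMeasurable hweight.1
  have hfinal : (1 : ENNReal) ≤ C * (m.toNNReal * (B * eLpNorm g 2 (volume.restrict Ω))) := by
    rw [← hLHS]
    refine hGNS.trans ?_
    gcongr
    exact hHolder
  rw [hg2] at hfinal
  have htop : (C * (m.toNNReal * (B * ENNReal.ofReal
      √(∫ x in Ω, ‖x‖ ^ β * |u x| ^ k * ‖gradient u x‖ ^ 2))) : ENNReal) ≠ ⊤ := by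
    finiteness
  have hreal := ENNReal.toReal_mono htop hfinal
  simp only [ENNReal.toReal_one, ENNReal.toReal_mul, ENNReal.coe_toReal,
    ENNReal.toReal_ofReal (Real.sqrt_nonneg _)] at hreal
  refine hreal.trans ?_
  rw [← mul_assoc (m.toNNReal : ℝ), ← mul_assoc (C : ℝ)]
  gcongr
  linarith

/-- The admissible class is nonempty. -/
lemma exists_normalized {n : ℕ} {Ω : Set (EuclideanSpace ℝ (Fin n))} (hΩo : IsOpen Ω)
    (h0 : 0 ∈ Ω) {q : ℝ} (hq : 0 < q) :
    ∃ u, smoothCpt n Ω u ∧ (∫ x in Ω, |u x| ^ q) = 1 := by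
  obtain ⟨ε, hε, hball⟩ := Metric.isOpen_iff.mp hΩo 0 h0
  let φ : ContDiffBump (0 : EuclideanSpace ℝ (Fin n)) := ⟨ε / 4, ε / 2, by linarith, by linarith⟩
  have hsupp : tsupport φ ⊆ Ω := by
    rw [φ.tsupport_eq]
    exact (Metric.closedBall_subset_ball (by change ε / 2 < ε; linarith)).trans hball
  have hcont : Continuous fun x => |φ x| ^ q :=
    φ.continuous.abs.rpow_const fun _ => Or.inr hq.le
  have hcpt : HasCompactSupport fun x => |φ x| ^ q := by
    refine φ.hasCompactSupport.mono fun x hx => ?_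
    contrapose! hx
    simp only [Function.mem_support, not_not] at hx ⊢
    simp [hx, hq.ne']
  have hint := hcont.integrable_of_hasCompactSupport (μ := volume) hcpt
  have hpos : 0 < ∫ x in Ω, |φ x| ^ q := by
    rw [setIntegral_eq_integral_of_forall_compl_eq_zero]
    · refine hcont.integral_pos_of_hasCompactSupport_nonneg_nonzero hcpt
        (fun x => by positivity) (x := 0) ?_
      have : φ 0 = 1 := φ.one_of_mem_closedBall (Metric.mem_closedBall_self φ.rIn_pos.le)
      simp [this]
    · intro x hx
      have : φ x = 0 := image_eq_zero_of_notMem_tsupport fun h => hx (hsupp h)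
      simp [this, hq.ne']
  set I := ∫ x in Ω, |φ x| ^ q with hI
  refine ⟨fun x => (I ^ q⁻¹)⁻¹ * φ x, ⟨?_, ?_, ?_⟩, ?_⟩
  · exact contDiff_const.mul φ.contDiff
  · exact φ.hasCompactSupport.mul_left
  · exact (closure_mono (Function.support_mul_subset_right _ _)).trans hsupp
  · have : ∀ x, |(I ^ q⁻¹)⁻¹ * φ x| ^ q = I⁻¹ * |φ x| ^ q := fun x => by
      rw [abs_mul, Real.mul_rpow (abs_nonneg _) (abs_nonneg _), abs_of_nonneg (by positivity),
        Real.inv_rpow (by positivity), Real.rpow_inv_rpow hpos.le hq.ne']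
    simp only [this, integral_const_mul]
    rw [← hI, inv_mul_cancel₀ hpos.ne']

/-- Subcritical case `0 ≤ β < kn/q`: the weighted infimum `S_Ω(β,k)` is strictly larger
than the best Sobolev constant `S`. -/
theorem stmt_0 (n : ℕ) (hn : 3 ≤ n) (q : ℝ) (hq : q = 2 * n / (n - 2))
    (Ω : Set (EuclideanSpace ℝ (Fin n))) (hΩo : IsOpen Ω)
    (hΩb : Bornology.IsBounded Ω) (h0 : 0 ∈ Ω)
    (β k : ℝ) (hk0 : 0 < k) (hkq : k ≤ q) (hβ0 : 0 ≤ β) (hβ : β < k * n / q) :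
    Sbest n Ω q < Sw n Ω β k q := by
  have hn3 : (3 : ℝ) ≤ n := by exact_mod_cast hn
  have hq0 : 0 < q := by rw [hq]; apply div_pos <;> linarith
  obtain ⟨K, hK, hbound⟩ := exists_weighted_bound hn hq hΩb hk0 hkq hβ0 hβ
  have hgap : Sbest n Ω q + (1 / K) ^ 2 ≤ Sw n Ω β k q := by
    obtain ⟨u₀, hu₀, hnorm₀⟩ := exists_normalized hΩo h0 hq0
    refine le_csInf ⟨_, u₀, hu₀, hnorm₀, rfl⟩ ?_
    rintro _ ⟨u, hu, hnorm, rfl⟩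
    have hcpt := hasCompactSupport_gradient hu.2.1
    have hint1 : Integrable (fun x => ‖gradient u x‖ ^ 2) := by
      refine Continuous.integrable_of_hasCompactSupport ?_ (hcpt.mono fun x hx => ?_)
      · simp only [norm_gradient_eq_norm_fderiv]
        exact (hu.1.continuous_fderiv (by simp)).norm.pow 2
      · contrapose! hx
        simp only [Function.mem_support, not_not] at hx ⊢
        simp [hx]
    have hint2 : Integrable (fun x => ‖x‖ ^ β * |u x| ^ k * ‖gradient u x‖ ^ 2) := by
      refine (continuous_weighted_density hk0.le hβ0 hu.1).integrable_of_hasCompactSupport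
        (hcpt.mono fun x hx => ?_)
      contrapose! hx
      simp only [Function.mem_support, not_not] at hx ⊢
      simp [hx]
    have hsplit : energy n Ω β k u = (∫ x in Ω, ‖gradient u x‖ ^ 2) +
        ∫ x in Ω, ‖x‖ ^ β * |u x| ^ k * ‖gradient u x‖ ^ 2 := by
      rw [← integral_add hint1.integrableOn hint2.integrableOn, energy]
      simp only [add_mul, one_mul]
    rw [hsplit]
    refine add_le_add (csInf_le ⟨0, ?_⟩ ⟨u, hu, hnorm, rfl⟩) ?_
    · rintro _ ⟨v, -, -, rfl⟩
      positivity
    · have h1 := hbound u hu hnorm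
      have h2 : 1 / K ≤ √(∫ x in Ω, ‖x‖ ^ β * |u x| ^ k * ‖gradient u x‖ ^ 2) := by
        rwa [div_le_iff₀' hK]
      exact (Real.le_sqrt' (by positivity)).mp h2
  have : 0 < (1 / K) ^ 2 := by positivity
  linarith

end
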